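/- Let R be a K-algebra with an (ℕ^n,⪯)-filtration F whose associated graded algebra G(R) is an iterated Ore extension over Λ = F_0(R) on homogeneous elements y_1,…,y_s of degrees α_1,…,α_s, with y_i a = σ_i(a) y_i for a ∈ Λ and y_j y_i = q_{ji} y_i y_j. Assume moreover that Λ is left noetherian and that each F_α(R) is a finitely generated left Λ-module, and choose lifts x_i ∈ F_{α_i}(R) of the y_i. Then: (1) for each i = 1,…,s there is a finite set Γ_i ⊆ { γ ∈ ℕ^s : γM ≺ α_i } such that x_i a − σ_i(a) x_i ∈ Σ_{γ ∈ Γ_i} Λ x^γ for every a ∈ Λ; and (2) for each 1 ≤ i < j ≤ s there is a finite set Γ_{ij} ⊆ { γ ∈ ℕ^s : γM ≺ α_i + α_j } such that x_j x_i − q_{ji} x_i x_j ∈ Σ_{γ ∈ Γ_{ij}} Λ x^γ. -/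

import Mathlib

open scoped BigOperators

/-- Multi-indices: elements of `ℕ^n`. -/
abbrev MIdx (n : ℕ) := Fin n → ℕ

/-- An admissible order on `ℕ^n`: a total order compatible with addition and having `0` as
least element. -/
structure AdmOrder (n : ℕ) where
  le : MIdx n → MIdx n → Prop
  le_refl : ∀ a, le a a
  le_trans : ∀ {a b c}, le a b → le b c → le a c
  le_antisymm : ∀ {a b}, le a b → le b a → a = b
  le_total : ∀ a b, le a b ∨ le b a
  add_right : ∀ {a b : MIdx n} (c : MIdx n), le a b → le (a + c) (b + c)
  zero_le : ∀ a, le 0 a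

/-- The strict order associated to an admissible order. -/
def AdmOrder.lt {n : ℕ} (o : AdmOrder n) (a b : MIdx n) : Prop :=
  o.le a b ∧ a ≠ b

/-- The ordered standard monomial `x^γ = x₁^{γ₁} ⋯ x_s^{γ_s}`. -/
def smon {R : Type*} [Monoid R] {s : ℕ} (x : Fin s → R) (γ : MIdx s) : R :=
  (List.ofFn fun i => x i ^ γ i).prod

/-- A `K`-algebra `R` with an `(ℕ^n,⪯)`-filtration `F` whose associated graded algebra
`G(R)` is an iterated Ore extension `Λ[y₁;σ₁]⋯[y_s;σ_s]` over `Λ = F₀(R)` on homogeneous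
elements `y_i` of degree `deg i`, together with chosen lifts `x i ∈ F_{deg i}(R)` of the
`y_i`.  All conditions on `G(R)` are expressed at the filtered level, with
`F_{≺δ}(R) = ⋃_{β ≺ δ} F_β(R)` and `y_i = x_i + F_{≺ deg i}(R)`:
* `span`/`indep` say that the standard monomials `y^γ` (classes of `x^γ` in degree
  `γM = Σ γᵢ·deg i`) form a basis of `G(R)` as a left `Λ`-module;
* `ore_comm` says `y_i·a = σ_i(a)·y_i` for `a ∈ Λ`;
* `q_comm` says `y_j·y_i = q_{ji}·y_i·y_j` for `i < j`. -/
structure OreGradedFiltration (K : Type*) [CommRing K] (R : Type*) [Ring R] [Algebra K R]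
    (n s : ℕ) where
  /-- the admissible order `⪯` on `ℕ^n` -/
  o : AdmOrder n
  /-- the `(ℕ^n,⪯)`-filtration on `R` -/
  F : MIdx n → Submodule K R
  F_mono : ∀ {a b : MIdx n}, o.le a b → F a ≤ F b
  F_mul : ∀ {a b : MIdx n} {u v : R}, u ∈ F a → v ∈ F b → u * v ∈ F (a + b)
  F_exhaustive : ∀ r : R, ∃ a : MIdx n, r ∈ F a
  F_one : (1 : R) ∈ F 0
  /-- `Λ = F₀(R)`, as a subalgebra of `R` -/
  Λ : Subalgebra K R
  hΛ : Subalgebra.toSubmodule Λ = F 0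
  /-- the degrees `α_i` of the homogeneous elements `y_i` -/
  deg : Fin s → MIdx n
  /-- lifts `x_i ∈ F_{α_i}(R)` of the `y_i` -/
  x : Fin s → R
  x_mem : ∀ i, x i ∈ F (deg i)
  /-- the Ore endomorphisms `σ_i` of `Λ` -/
  σ : Fin s → (Λ →+* Λ)
  /-- the commutation scalars `q_{ji} ∈ Λ` -/
  q : Fin s → Fin s → R
  q_mem : ∀ i j : Fin s, q i j ∈ F 0
  /-- `y_i·a = σ_i(a)·y_i` in `G(R)`, for `a ∈ Λ` -/
  ore_comm : ∀ (i : Fin s) (a : Λ),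
    x i * (a : R) - (σ i a : R) * x i ∈ ⨆ β ∈ {β : MIdx n | o.lt β (deg i)}, F β
  /-- `y_j·y_i = q_{ji}·y_i·y_j` in `G(R)`, for `i < j` -/
  q_comm : ∀ i j : Fin s, i < j →
    x j * x i - q j i * (x i * x j) ∈ ⨆ β ∈ {β : MIdx n | o.lt β (deg i + deg j)}, F β
  /-- the monomials `y^γ` span `G(R)` over `Λ` -/
  span : ∀ δ : MIdx n, ∀ r ∈ F δ, ∃ c : MIdx s →₀ R,
    (∀ γ, c γ ∈ F 0) ∧ (∀ γ ∈ c.support, (∑ i, γ i • deg i) = δ) ∧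
    r - (c.sum fun γ a => a * smon x γ) ∈ ⨆ β ∈ {β : MIdx n | o.lt β δ}, F β
  /-- the monomials `y^γ` are left `Λ`-linearly independent in `G(R)` -/
  indep : ∀ (δ : MIdx n) (c : MIdx s →₀ R),
    (∀ γ, c γ ∈ F 0) → (∀ γ ∈ c.support, (∑ i, γ i • deg i) = δ) →
    (c.sum fun γ a => a * smon x γ) ∈ (⨆ β ∈ {β : MIdx n | o.lt β δ}, F β) → c = 0

namespace OreGradedFiltration

variable {K : Type*} [CommRing K] {R : Type*} [Ring R] [Algebra K R] {n s : ℕ}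

/-- `F_{≺δ}(R) = ⋃_{β ≺ δ} F_β(R)`. -/
def Flt (E : OreGradedFiltration K R n s) (δ : MIdx n) : Submodule K R :=
  ⨆ β ∈ {β : MIdx n | E.o.lt β δ}, E.F β

/-- `γM = γ₁α₁ + ⋯ + γ_sα_s ∈ ℕ^n`. -/
def degM (E : OreGradedFiltration K R n s) (γ : MIdx s) : MIdx n :=
  ∑ i, γ i • E.deg i

end OreGradedFiltration

namespace AdmOrder

variable {n : ℕ}

theorem le_of_pointwise_le (o : AdmOrder n) {a b : MIdx n} (h : a ≤ b) : o.le a b := by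
  simpa [tsub_add_cancel_of_le h] using o.add_right a (o.zero_le (b - a))

theorem lt_of_le_of_lt (o : AdmOrder n) {a b c : MIdx n} (hab : o.le a b) (hbc : o.lt b c) :
    o.lt a c := by
  refine ⟨o.le_trans hab hbc.1, ?_⟩
  rintro rfl
  exact hbc.2 (o.le_antisymm hbc.1 hab)

/-- By Dickson's lemma, every admissible order is well-founded. -/
theorem wellFounded_lt (o : AdmOrder n) : WellFounded o.lt := by
  have : IsStrictOrder (MIdx n) o.lt :=
    { irrefl := fun _ h => h.2 rfl
      trans := fun _ _ _ hab hbc => o.lt_of_le_of_lt hab.1 hbc }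
  rw [RelEmbedding.wellFounded_iff_isEmpty]
  refine ⟨fun f => ?_⟩
  obtain ⟨i, j, hij, hle⟩ := wellQuasiOrdered_le (α := MIdx n) f
  have hlt : o.lt (f j) (f i) := f.map_rel_iff.2 hij
  exact hlt.2 (o.le_antisymm hlt.1 (o.le_of_pointwise_le hle))

end AdmOrder

namespace OreGradedFiltration

variable {K : Type*} [CommRing K] {R : Type*} [Ring R] [Algebra K R] {n s : ℕ}

theorem mem_Λ_iff (E : OreGradedFiltration K R n s) {r : R} : r ∈ E.Λ ↔ r ∈ E.F 0 := by
  rw [← E.hΛ, Subalgebra.mem_toSubmodule]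

/-- `F_α(R)` as a left `Λ`-submodule of `R`. -/
def leftF (E : OreGradedFiltration K R n s) (α : MIdx n) : Submodule E.Λ R where
  carrier := E.F α
  add_mem' := (E.F α).add_mem
  zero_mem' := (E.F α).zero_mem
  smul_mem' a r hr := by
    have h := E.F_mul (E.mem_Λ_iff.1 a.2) hr
    rwa [zero_add] at h

theorem pow_mem_F (E : OreGradedFiltration K R n s) {α : MIdx n} {r : R} (hr : r ∈ E.F α)
    (k : ℕ) : r ^ k ∈ E.F (k • α) := by
  induction k with
  | zero => simpa using E.F_one
  | succ k ih => rw [pow_succ, succ_nsmul]; exact E.F_mul ih hr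

theorem prod_ofFn_mem_F (E : OreGradedFiltration K R n s) {m : ℕ} {u : Fin m → R}
    {α : Fin m → MIdx n} (hu : ∀ i, u i ∈ E.F (α i)) :
    (List.ofFn u).prod ∈ E.F (∑ i, α i) := by
  induction m with
  | zero => simpa using E.F_one
  | succ m ih =>
    rw [List.ofFn_succ, List.prod_cons, Fin.sum_univ_succ]
    exact E.F_mul (hu 0) (ih fun i => hu i.succ)

theorem smon_mem_F (E : OreGradedFiltration K R n s) (γ : MIdx s) :
    smon E.x γ ∈ E.F (E.degM γ) :=
  E.prod_ofFn_mem_F fun i => E.pow_mem_F (E.x_mem i) (γ i)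

theorem mem_span_smon_of_mem_F (E : OreGradedFiltration K R n s) (δ : MIdx n) :
    ∀ r ∈ E.F δ, r ∈ Submodule.span E.Λ (smon E.x '' {γ | E.o.le (E.degM γ) δ}) := by
  induction δ using E.o.wellFounded_lt.induction with
  | _ δ ih =>
    intro r hr
    obtain ⟨c, hc, hdeg, hrem⟩ := E.span δ r hr
    have hlower : (⨆ β ∈ {β : MIdx n | E.o.lt β δ}, E.F β) ≤
        (Submodule.span E.Λ (smon E.x '' {γ | E.o.le (E.degM γ) δ})).restrictScalars K :=
      iSup₂_le fun β hβ u hu => Submodule.span_mono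
        (Set.image_mono fun γ hγ => E.o.le_trans hγ hβ.1) (ih β hβ u hu)
    rw [← sub_add_cancel r (c.sum fun γ a => a * smon E.x γ)]
    refine add_mem (hlower hrem) (sum_mem fun γ hγ => ?_)
    refine Submodule.smul_mem _ (⟨c γ, E.mem_Λ_iff.2 (hc γ)⟩ : E.Λ)
      (Submodule.subset_span ⟨γ, ?_, rfl⟩)
    change E.o.le (∑ i, γ i • E.deg i) δ
    rw [hdeg γ hγ]
    exact E.o.le_refl δ

theorem mem_span_smon_of_mem_Flt (E : OreGradedFiltration K R n s) {δ : MIdx n} {r : R}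
    (hr : r ∈ E.Flt δ) :
    r ∈ Submodule.span E.Λ (smon E.x '' {γ | E.o.lt (E.degM γ) δ}) := by
  have h : E.Flt δ ≤
      (Submodule.span E.Λ (smon E.x '' {γ | E.o.lt (E.degM γ) δ})).restrictScalars K :=
    iSup₂_le fun β hβ u hu => Submodule.span_mono
      (Set.image_mono fun γ hγ => E.o.lt_of_le_of_lt hγ hβ) (E.mem_span_smon_of_mem_F β u hu)
  exact h hr

theorem span_smon_le_leftF (E : OreGradedFiltration K R n s) (δ : MIdx n) :
    Submodule.span E.Λ (smon E.x '' {γ | E.o.lt (E.degM γ) δ}) ≤ E.leftF δ := by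
  rw [Submodule.span_le]
  rintro _ ⟨γ, hγ, rfl⟩
  exact E.F_mono hγ.1 (E.smon_mem_F γ)

theorem leftF_fg (E : OreGradedFiltration K R n s) {α : MIdx n}
    (h : ∃ T : Finset R, (↑T : Set R) ⊆ E.F α ∧
      ∀ r ∈ E.F α, ∃ c : R → R, (∀ t, c t ∈ E.F 0) ∧ r = ∑ t ∈ T, c t * t) :
    (E.leftF α).FG := by
  obtain ⟨T, hT, hgen⟩ := h
  refine ⟨T, le_antisymm (Submodule.span_le.2 hT) fun r hr => ?_⟩
  obtain ⟨c, hc, rfl⟩ := hgen r hr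
  exact sum_mem fun t ht => Submodule.smul_mem _ (⟨c t, E.mem_Λ_iff.2 (hc t)⟩ : E.Λ)
    (Submodule.subset_span ht)

/-- If `Λ` is left noetherian and `F_δ(R)` is finitely generated, then finitely many standard
monomials `x^γ` with `γM ≺ δ` suffice to express all elements of `F_{≺δ}(R)`. -/
theorem exists_finset_smon_of_mem_Flt (E : OreGradedFiltration K R n s)
    (hNoeth : IsNoetherianRing E.Λ) {δ : MIdx n} (hFG : (E.leftF δ).FG) :
    ∃ Γ : Finset (MIdx s), (∀ γ ∈ Γ, E.o.lt (E.degM γ) δ) ∧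
      ∀ r ∈ E.Flt δ, ∃ c : MIdx s → R, (∀ γ, c γ ∈ E.F 0) ∧
        r = ∑ γ ∈ Γ, c γ * smon E.x γ := by
  classical
  have hN : IsNoetherian E.Λ (E.leftF δ) := isNoetherian_of_fg_of_noetherian _ hFG
  have hfg := isNoetherian_submodule.1 hN _ (E.span_smon_le_leftF δ)
  obtain ⟨S, hS, hspan⟩ := Submodule.fg_span_iff_fg_span_finset_subset _ |>.1 hfg
  obtain ⟨Γ, hΓ, rfl⟩ := Finset.subset_set_image_iff.1 hS
  refine ⟨Γ, fun γ hγ => hΓ hγ, fun r hr => ?_⟩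
  have hmem := E.mem_span_smon_of_mem_Flt hr
  rw [hspan, Finset.coe_image, Submodule.mem_span_image_finset_iff_exists_fun] at hmem
  obtain ⟨c, hc⟩ := hmem
  refine ⟨fun γ => if h : γ ∈ Γ then c ⟨γ, h⟩ else 0, fun γ => ?_, ?_⟩
  · dsimp only
    split_ifs with h
    exacts [E.mem_Λ_iff.1 (c ⟨γ, h⟩).2, zero_mem _]
  · rw [← hc, ← Finset.sum_coe_sort Γ]
    simp [Subalgebra.smul_def]

end OreGradedFiltration

/-- Assume moreover that `Λ` is left noetherian and each `F_α(R)` is a finitely generated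
left `Λ`-module.  Then: (1) for each `i` there is a finite set
`Γ_i ⊆ {γ : γM ≺ α_i}` with `x_i·a − σ_i(a)·x_i ∈ Σ_{γ ∈ Γ_i} Λx^γ` for every `a ∈ Λ`;
and (2) for each `i < j` there is a finite set `Γ_{ij} ⊆ {γ : γM ≺ α_i + α_j}` with
`x_j·x_i − q_{ji}·x_i·x_j ∈ Σ_{γ ∈ Γ_{ij}} Λx^γ`. -/
theorem oreGraded_finite_tails {K : Type*} [CommRing K] {R : Type*} [Ring R]
    [Algebra K R] {n s : ℕ} (E : OreGradedFiltration K R n s)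
    (hNoeth : IsNoetherianRing E.Λ)
    (hFG : ∀ α : MIdx n, ∃ T : Finset R, (↑T : Set R) ⊆ E.F α ∧
      ∀ r ∈ E.F α, ∃ c : R → R, (∀ t, c t ∈ E.F 0) ∧ r = ∑ t ∈ T, c t * t) :
    (∀ i : Fin s, ∃ Γi : Finset (MIdx s),
      (∀ γ ∈ Γi, E.o.lt (E.degM γ) (E.deg i)) ∧
      ∀ a : E.Λ, ∃ c : MIdx s → R, (∀ γ, c γ ∈ E.F 0) ∧
        E.x i * (a : R) - (E.σ i a : R) * E.x i = ∑ γ ∈ Γi, c γ * smon E.x γ) ∧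
    (∀ i j : Fin s, i < j → ∃ Γij : Finset (MIdx s),
      (∀ γ ∈ Γij, E.o.lt (E.degM γ) (E.deg i + E.deg j)) ∧
      ∃ c : MIdx s → R, (∀ γ, c γ ∈ E.F 0) ∧
        E.x j * E.x i - E.q j i * (E.x i * E.x j) = ∑ γ ∈ Γij, c γ * smon E.x γ) := by
  have key := fun δ => E.exists_finset_smon_of_mem_Flt hNoeth (E.leftF_fg (hFG δ))
  refine ⟨fun i => ?_, fun i j hij => ?_⟩
  · obtain ⟨Γ, hΓ, hc⟩ := key (E.deg i)
    exact ⟨Γ, hΓ, fun a => hc _ (E.ore_comm i a)⟩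
  · obtain ⟨Γ, hΓ, hc⟩ := key (E.deg i + E.deg j)
    exact ⟨Γ, hΓ, hc _ (E.q_comm i j hij)⟩
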